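/- Suppose (log n)^2/√n ≤ p ≤ 1 - (log n)^2/√n and let η > 0. Then for every r > 0 there is n_0 = n_0(η, r) such that for all n ≥ n_0, with probability at least 1 - 1/n^r, the Eulerian edit number N_edit(G(n,p)) lies between n/4 - n^{1/2+η} and n/4 + n^{1/2+η}. -/

import Mathlib

open MeasureTheory

/-- Bernoulli(p) measure on `Bool`. -/
noncomputable def bern (p : ℝ) : Measure Bool :=
  (Real.toNNReal p) • Measure.dirac true + (Real.toNNReal (1 - p)) • Measure.dirac false

instance (p : ℝ) : IsFiniteMeasure (bern p) := by
  unfold bern; infer_instance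

/-- The Erdős–Rényi measure: each potential edge (element of `Sym2 (Fin n)`)
is present (`true`) independently with probability `p`. -/
noncomputable def erMeasure (n : ℕ) (p : ℝ) : Measure (Sym2 (Fin n) → Bool) :=
  Measure.pi fun _ => bern p

/-- The random graph determined by the sample point `ω`. -/
def erGraph (n : ℕ) (ω : Sym2 (Fin n) → Bool) : SimpleGraph (Fin n) :=
  SimpleGraph.fromEdgeSet {e | ω e = true}

/-- Degree of a vertex. -/
noncomputable def degN {V : Type*} (G : SimpleGraph V) (v : V) : ℕ :=
  Nat.card (G.neighborSet v)

/-- Number of odd-degree vertices. -/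
noncomputable def oddCount (n : ℕ) (ω : Sym2 (Fin n) → Bool) : ℕ :=
  Nat.card {v : Fin n // Odd (degN (erGraph n ω) v)}

/-- A graph is Eulerian iff it is connected, every vertex has even degree,
and it has at least one edge. -/
def IsEulerian {V : Type*} (G : SimpleGraph V) : Prop :=
  G.Connected ∧ (∀ v, Even (degN G v)) ∧ G.edgeSet.Nonempty

/-- The minimum number of single-edge edits (additions or deletions) needed to
transform `G` into `H`: the size of the symmetric difference of edge sets. -/
noncomputable def editCount {V : Type*} (G H : SimpleGraph V) : ℕ :=
  Nat.card ↥(symmDiff G.edgeSet H.edgeSet)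

/-- Eulerian edit number: minimum number of single-edge additions/deletions
needed to turn `G` into an Eulerian graph. -/
noncomputable def Nedit {V : Type*} (G : SimpleGraph V) : ℕ :=
  sInf {k | ∃ H : SimpleGraph V, IsEulerian H ∧ editCount G H = k}

/-- Eulerian extension number: minimum number of edge additions making `G` Eulerian. -/
noncomputable def Next {V : Type*} (G : SimpleGraph V) : ℕ :=
  sInf {k | ∃ H : SimpleGraph V, IsEulerian H ∧ G ≤ H ∧ Nat.card ↥(H.edgeSet \ G.edgeSet) = k}

/-- Eulerian reduction number: minimum number of edge deletions making `G` Eulerian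
(with at least one edge remaining). -/
noncomputable def Nred {V : Type*} (G : SimpleGraph V) : ℕ :=
  sInf {k | ∃ H : SimpleGraph V, IsEulerian H ∧ H ≤ G ∧ Nat.card ↥(G.edgeSet \ H.edgeSet) = k}

/-- An even finite set carries a fixed-point-free involution, extended by the identity, whose
orbits give at most half as many unordered pairs. -/
lemma exists_pairing {V : Type*} [DecidableEq V] (m : ℕ) (O : Finset V)
    (hO : O.card = 2 * m) :
    ∃ f : V → V, Function.Involutive f ∧ (∀ v, f v ≠ v ↔ v ∈ O) ∧
      ∃ M : Finset (Sym2 V), M.card ≤ m ∧ ∀ v ∈ O, s(v, f v) ∈ M := by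
  induction m generalizing O with
  | zero =>
    have : O = ∅ := by simpa using hO
    subst this
    exact ⟨id, fun _ => rfl, by simp, ∅, by simp⟩
  | succ m ih =>
    obtain ⟨a, ha⟩ : O.Nonempty := Finset.card_pos.mp (by omega)
    obtain ⟨b, hb⟩ : (O.erase a).Nonempty :=
      Finset.card_pos.mp (by rw [Finset.card_erase_of_mem ha]; omega)
    have hcard : ((O.erase a).erase b).card = 2 * m := by
      rw [Finset.card_erase_of_mem hb, Finset.card_erase_of_mem ha]; omega
    obtain ⟨f, hf, hfO, M, hM, hMO⟩ := ih _ hcard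
    have hba : b ≠ a := (Finset.mem_erase.mp hb).1
    have hbO : b ∈ O := (Finset.mem_erase.mp hb).2
    have hfa : f a = a := by
      by_contra h
      have := (hfO a).mp h
      simp at this
    have hfb : f b = b := by
      by_contra h
      have := (hfO b).mp h
      simp at this
    have hne_a : ∀ v, v ≠ a → f v ≠ a := fun v hv h => hv (by rw [← hf v, h, hfa])
    have hne_b : ∀ v, v ≠ b → f v ≠ b := fun v hv h => hv (by rw [← hf v, h, hfb])
    refine ⟨fun v => if v = a then b else if v = b then a else f v, ?_, ?_,
      insert s(a, b) M, (Finset.card_insert_le _ _).trans (by omega), ?_⟩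
    · intro v
      by_cases h1 : v = a
      · simp [h1, hba]
      · by_cases h2 : v = b
        · simp [h2, hba]
        · simp [h1, h2, hne_a v h1, hne_b v h2, hf v]
    · intro v
      by_cases h1 : v = a
      · simp [h1, hba, ha]
      · by_cases h2 : v = b
        · simp [h2, hba, hba.symm, hbO]
        · simpa [h1, h2] using hfO v
    · intro v hv
      by_cases h1 : v = a
      · simp [h1]
      · by_cases h2 : v = b
        · simp [h2, hba, Sym2.eq_swap]
        · have := hMO v (by simp [h1, h2, hv])
          simp [h1, h2, this]

/-- The graph obtained from `G` by flipping all the pairs `{v, f v}` with `f v ≠ v`. -/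
def SimpleGraph.toggle {V : Type*} (G : SimpleGraph V) (f : V → V) (hf : Function.Involutive f) :
    SimpleGraph V where
  Adj u v := u ≠ v ∧ (G.Adj u v ↔ f u ≠ v)
  symm := ⟨fun u v h => ⟨h.1.symm, by
    rw [G.adj_comm, h.2, not_iff_not]
    exact ⟨fun e => by rw [← e, hf], fun e => by rw [← e, hf]⟩⟩⟩
  loopless := ⟨fun _ h => h.1 rfl⟩

lemma even_degN_toggle {V : Type*} [Finite V] (G : SimpleGraph V) (f : V → V)
    (hf : Function.Involutive f) (hodd : ∀ v, f v ≠ v ↔ Odd (degN G v)) (v : V) :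
    Even (degN (G.toggle f hf) v) := by
  by_cases hv : f v = v
  · have hset : (G.toggle f hf).neighborSet v = G.neighborSet v := by
      ext w
      simp only [SimpleGraph.mem_neighborSet, SimpleGraph.toggle, hv]
      exact ⟨fun h => h.2.mpr h.1, fun h => ⟨h.ne, by simp [h, h.ne]⟩⟩
    have := mt (hodd v).mpr (by simpa using hv)
    rw [degN, hset]
    simpa [degN] using this
  · have h1 := (hodd v).mp hv
    rw [degN, Nat.card_coe_set_eq] at h1 ⊢
    by_cases ha : G.Adj v (f v)
    · have hset : (G.toggle f hf).neighborSet v = G.neighborSet v \ {f v} := by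
        ext w
        simp only [SimpleGraph.mem_neighborSet, SimpleGraph.toggle, Set.mem_sdiff,
          Set.mem_singleton_iff]
        by_cases hw : w = f v
        · subst hw; simp [ha]
        · simp only [hw, Ne.symm hw, ne_eq, not_false_eq_true, iff_true, and_true]
          exact ⟨fun h => h.2, fun h => ⟨h.ne, h⟩⟩
      have h2 := Set.ncard_sdiff_singleton_add_one (s := G.neighborSet v) (a := f v) ha
        (Set.toFinite _)
      rw [hset]
      rw [← h2] at h1
      grind
    · have hset : (G.toggle f hf).neighborSet v = insert (f v) (G.neighborSet v) := by
        ext w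
        simp only [SimpleGraph.mem_neighborSet, SimpleGraph.toggle, Set.mem_insert_iff]
        by_cases hw : w = f v
        · subst hw; simp [ha, Ne.symm hv]
        · simp only [hw, Ne.symm hw, ne_eq, not_false_eq_true, iff_true, false_or]
          exact ⟨fun h => h.2, fun h => ⟨h.ne, h⟩⟩
      rw [hset, Set.ncard_insert_of_notMem (by simpa using ha) (Set.toFinite _)]
      exact h1.add_one

/-- Any two vertices have a common neighbour outside any two prescribed vertices. -/
def RobustlyLinked {V : Type*} (G : SimpleGraph V) : Prop :=
  ∀ u v, u ≠ v → ∀ a b, ∃ w, w ≠ a ∧ w ≠ b ∧ G.Adj u w ∧ G.Adj v w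

lemma connected_toggle {V : Type*} [Nontrivial V] {G : SimpleGraph V} (hG : RobustlyLinked G)
    (f : V → V) (hf : Function.Involutive f) : (G.toggle f hf).Connected := by
  refine ⟨fun u v => ?_⟩
  by_cases huv : u = v
  · rw [huv]
  · obtain ⟨w, hw1, hw2, h1, h2⟩ := hG u v huv (f u) (f v)
    have e1 : (G.toggle f hf).Adj u w := ⟨h1.ne, by simp [h1, hw1.symm]⟩
    have e2 : (G.toggle f hf).Adj v w := ⟨h2.ne, by simp [h2, hw2.symm]⟩
    exact e1.reachable.trans e2.reachable.symm

lemma even_card_odd_degN {V : Type*} [Fintype V] (G : SimpleGraph V)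
    [DecidablePred fun v => Odd (degN G v)] :
    Even (Finset.univ.filter fun v => Odd (degN G v)).card := by
  classical
  convert G.even_card_odd_degree_vertices using 6
  rw [degN, Nat.card_eq_fintype_card, SimpleGraph.card_neighborSet_eq_degree]

/-- Every odd vertex lies on an edited edge. -/
lemma card_odd_le_two_mul_editCount {V : Type*} [Fintype V] (G H : SimpleGraph V)
    [DecidablePred fun v => Odd (degN G v)] (hH : ∀ v, Even (degN H v)) :
    (Finset.univ.filter fun v => Odd (degN G v)).card ≤ 2 * editCount G H := by
  classical
  have hsub : (Finset.univ.filter fun v => Odd (degN G v)) ⊆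
      (symmDiff G.edgeSet H.edgeSet).toFinset.biUnion Sym2.toFinset := by
    intro v hv
    simp only [Finset.mem_filter, Finset.mem_univ, true_and] at hv
    by_contra hcon
    have hset : G.neighborSet v = H.neighborSet v := by
      ext w
      by_contra hw
      apply hcon
      simp only [Finset.mem_biUnion, Set.mem_toFinset, Sym2.mem_toFinset]
      refine ⟨s(v, w), ?_, Sym2.mem_mk_left v w⟩
      simp only [SimpleGraph.mem_neighborSet] at hw
      simp only [Set.mem_symmDiff, SimpleGraph.mem_edgeSet]
      tauto
    rw [degN, hset] at hv
    exact (Nat.not_odd_iff_even.mpr (hH v)) hv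
  refine (Finset.card_le_card hsub).trans ?_
  refine (Finset.card_biUnion_le_card_mul _ _ 2 fun e _ => ?_).trans ?_
  · rw [Sym2.card_toFinset]; split_ifs <;> simp
  · rw [editCount, Nat.card_eq_fintype_card, Set.toFinset_card, mul_comm]

/-- In a robustly linked graph the Eulerian edit number is half the number of odd vertices. -/
lemma two_mul_Nedit {V : Type*} [Fintype V] [Nontrivial V] (G : SimpleGraph V)
    [DecidablePred fun v => Odd (degN G v)] (hG : RobustlyLinked G) :
    2 * Nedit G = (Finset.univ.filter fun v => Odd (degN G v)).card := by
  classical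
  obtain ⟨m, hm⟩ := even_card_odd_degN G
  obtain ⟨f, hf, hfO, M, hM, hMO⟩ :=
    exists_pairing m (Finset.univ.filter fun v => Odd (degN G v)) (by omega)
  have hfO' : ∀ v, f v ≠ v ↔ Odd (degN G v) := by simpa using hfO
  have hconn := connected_toggle hG f hf
  have hE : IsEulerian (G.toggle f hf) := by
    refine ⟨hconn, even_degN_toggle G f hf hfO', ?_⟩
    obtain ⟨u, v, huv⟩ := exists_pair_ne V
    obtain ⟨w, hw1, hw2, h1, h2⟩ := hG u v huv (f u) (f u)
    have e1 : (G.toggle f hf).Adj u w := ⟨h1.ne, by simp [h1, hw1.symm]⟩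
    exact ⟨s(u, w), e1⟩
  have hle : editCount G (G.toggle f hf) ≤ m := by
    have hsub : symmDiff G.edgeSet (G.toggle f hf).edgeSet ⊆ (M : Set (Sym2 V)) := by
      intro e
      induction e using Sym2.ind with
      | _ u v =>
        intro he
        simp only [Set.mem_symmDiff, SimpleGraph.mem_edgeSet, SimpleGraph.toggle] at he
        have huv : u ≠ v := by
          rcases he with h | h
          · exact h.1.ne
          · exact h.1.1
        have hfu : f u = v := by tauto
        subst hfu
        exact hMO u ((hfO u).mp huv.symm)
    rw [editCount, Nat.card_coe_set_eq]
    refine (Set.ncard_le_ncard hsub (Finset.finite_toSet M)).trans ?_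
    rwa [Set.ncard_coe_finset]
  have hupper : Nedit G ≤ m := by
    refine (Nat.sInf_le ?_).trans hle
    exact Set.mem_ofPred.mpr ⟨_, hE, rfl⟩
  obtain ⟨H, hH, hHk⟩ : Nedit G ∈ {k | ∃ H : SimpleGraph V, IsEulerian H ∧ editCount G H = k} :=
    Nat.sInf_mem ⟨_, Set.mem_ofPred.mpr ⟨_, hE, rfl⟩⟩
  have hlower := card_odd_le_two_mul_editCount G H hH.2.1
  omega

lemma isProbabilityMeasure_bern {p : ℝ} (h0 : 0 ≤ p) (h1 : p ≤ 1) :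
    IsProbabilityMeasure (bern p) := by
  constructor
  simp only [bern, Measure.add_apply, Measure.smul_apply, measure_univ]
  change (Real.toNNReal p : ENNReal) * 1 + (Real.toNNReal (1 - p) : ENNReal) * 1 = 1
  rw [mul_one, mul_one, ← ENNReal.coe_add, ← Real.toNNReal_add h0 (by linarith)]
  simp

lemma isProbabilityMeasure_erMeasure (n : ℕ) {p : ℝ} (h0 : 0 ≤ p) (h1 : p ≤ 1) :
    IsProbabilityMeasure (erMeasure n p) := by
  have := isProbabilityMeasure_bern h0 h1
  unfold erMeasure
  infer_instance

instance (n : ℕ) (p : ℝ) : IsFiniteMeasure (erMeasure n p) := by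
  unfold erMeasure
  infer_instance

lemma integral_bern {p : ℝ} (h0 : 0 ≤ p) (h1 : p ≤ 1) (f : Bool → ℝ) :
    ∫ b, f b ∂bern p = p * f true + (1 - p) * f false := by
  rw [bern, integral_add_measure Integrable.of_finite Integrable.of_finite,
    integral_smul_nnreal_measure, integral_smul_nnreal_measure, integral_dirac, integral_dirac,
    NNReal.smul_def, NNReal.smul_def, Real.coe_toNNReal _ h0, Real.coe_toNNReal _ (by linarith)]
  rfl

lemma integral_erMeasure_prod (n : ℕ) {p : ℝ} (h0 : 0 ≤ p) (h1 : p ≤ 1)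
    (f : Sym2 (Fin n) → Bool → ℝ) :
    ∫ ω, ∏ e, f e (ω e) ∂erMeasure n p = ∏ e, (p * f e true + (1 - p) * f e false) := by
  rw [erMeasure, integral_fintype_prod_eq_prod]
  exact Finset.prod_congr rfl fun e _ => integral_bern h0 h1 _

lemma neg_one_pow_degN (n : ℕ) (ω : Sym2 (Fin n) → Bool) (v : Fin n) :
    (-1 : ℝ) ^ degN (erGraph n ω) v =
      ∏ e : Sym2 (Fin n), if ω e = true ∧ v ∈ e ∧ ¬ e.IsDiag then (-1 : ℝ) else 1 := by
  classical
  rw [Finset.prod_ite, Finset.prod_const, Finset.prod_const_one, mul_one, degN,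
    Nat.card_eq_fintype_card, SimpleGraph.card_neighborSet_eq_degree,
    ← SimpleGraph.card_incidenceFinset_eq_degree]
  congr 2
  ext e
  rw [SimpleGraph.mem_incidenceFinset]
  simp only [SimpleGraph.incidenceSet, erGraph, SimpleGraph.edgeSet_fromEdgeSet,
    Set.mem_sdiff, Set.mem_ofPred_eq, Sym2.mem_diagSet, Finset.mem_filter, Finset.mem_univ,
    true_and]
  tauto

/-- A parity character of the degree sequence has exponentially small mean in terms of the size
of the corresponding edge cut. -/
lemma abs_integral_parity_le (n : ℕ) {p : ℝ} (h0 : 0 ≤ p) (h1 : p ≤ 1) (S : Finset (Fin n)) :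
    |∫ ω, ∏ v ∈ S, (-1 : ℝ) ^ degN (erGraph n ω) v ∂erMeasure n p|
      ≤ |1 - 2 * p| ^ (S.card * (n - S.card)) := by
  classical
  set f : Sym2 (Fin n) → Bool → ℝ := fun e b =>
    ∏ v ∈ S, if b = true ∧ v ∈ e ∧ ¬ e.IsDiag then (-1 : ℝ) else 1 with hf
  have hprod : ∀ ω : Sym2 (Fin n) → Bool,
      ∏ v ∈ S, (-1 : ℝ) ^ degN (erGraph n ω) v = ∏ e, f e (ω e) := by
    intro ω
    simp_rw [neg_one_pow_degN, hf]
    exact Finset.prod_comm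
  simp_rw [hprod]
  rw [integral_erMeasure_prod n h0 h1, Finset.abs_prod]
  have hfalse : ∀ e, f e false = 1 := fun e => by simp [hf]
  have habs : ∀ e, |f e true| = 1 := fun e => by
    simp only [hf, Finset.abs_prod]
    refine Finset.prod_eq_one fun v _ => ?_
    split_ifs <;> simp
  have hle : ∀ e, |p * f e true + (1 - p) * f e false| ≤ 1 := fun e => by
    refine (abs_add_le _ _).trans ?_
    rw [abs_mul, abs_mul, habs, hfalse, abs_one, abs_of_nonneg h0,
      abs_of_nonneg (by linarith : (0 : ℝ) ≤ 1 - p)]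
    linarith
  set C := (S ×ˢ Sᶜ).image fun x : Fin n × Fin n => s(x.1, x.2) with hC
  have hCcard : C.card = S.card * (n - S.card) := by
    rw [hC, Finset.card_image_of_injOn, Finset.card_product, Finset.card_compl, Fintype.card_fin]
    rintro ⟨a, b⟩ hab ⟨c, d⟩ hcd h
    simp only [Finset.coe_product, Finset.coe_compl, Set.mem_prod, Set.mem_compl_iff,
      Finset.mem_coe] at hab hcd
    simp only [Sym2.eq_iff] at h
    rcases h with ⟨rfl, rfl⟩ | ⟨rfl, rfl⟩
    · rfl
    · exact absurd hab.1 hcd.2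
  have hCval : ∀ e ∈ C, |p * f e true + (1 - p) * f e false| = |1 - 2 * p| := by
    intro e he
    obtain ⟨⟨a, b⟩, hab, rfl⟩ := Finset.mem_image.mp he
    simp only [Finset.mem_product, Finset.mem_compl] at hab
    have hne : a ≠ b := fun h => hab.2 (h ▸ hab.1)
    have : f s(a, b) true = -1 := by
      simp only [hf]
      rw [Finset.prod_eq_single a]
      · simp [hne]
      · intro v hv hva
        have hvb : v ≠ b := fun h => hab.2 (h ▸ hv)
        simp [hva, hvb]
      · exact fun h => absurd hab.1 h
    rw [this, hfalse]
    congr 1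
    ring
  calc ∏ e, |p * f e true + (1 - p) * f e false|
      ≤ ∏ e ∈ C, |p * f e true + (1 - p) * f e false| := by
        rw [← Finset.prod_mul_prod_compl C]
        exact mul_le_of_le_one_right (Finset.prod_nonneg fun _ _ => abs_nonneg _)
          (Finset.prod_le_one (fun _ _ => abs_nonneg _) fun e _ => hle e)
    _ = |1 - 2 * p| ^ (S.card * (n - S.card)) := by
        rw [Finset.prod_congr rfl hCval, Finset.prod_const, hCcard]

/-- Sum of the signs of the degrees. -/
noncomputable def signSum (n : ℕ) (ω : Sym2 (Fin n) → Bool) : ℝ :=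
  ∑ v, (-1 : ℝ) ^ degN (erGraph n ω) v

lemma signSum_eq (n : ℕ) (ω : Sym2 (Fin n) → Bool)
    [DecidablePred fun v => Odd (degN (erGraph n ω) v)] :
    signSum n ω = n - 2 * ((Finset.univ.filter fun v => Odd (degN (erGraph n ω) v)).card : ℝ) := by
  have h : ∀ v, (-1 : ℝ) ^ degN (erGraph n ω) v =
      1 - 2 * (if Odd (degN (erGraph n ω) v) then 1 else 0) := by
    intro v
    split_ifs with hv
    · rw [hv.neg_one_pow]; norm_num
    · rw [(Nat.not_odd_iff_even.mp hv).neg_one_pow]; norm_num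
  rw [signSum, Finset.sum_congr rfl fun v _ => h v, Finset.sum_sub_distrib, ← Finset.mul_sum,
    Finset.sum_boole]
  simp

lemma mgf_signSum_le (n : ℕ) {p : ℝ} (h0 : 0 ≤ p) (h1 : p ≤ 1) (t : ℝ) :
    ProbabilityTheory.mgf (signSum n) (erMeasure n p) t ≤
      Real.exp (n * t ^ 2 / 2) *
        ∑ S : Finset (Fin n), |1 - 2 * p| ^ (S.card * (n - S.card)) := by
  have hexp : ∀ ω, Real.exp (t * signSum n ω) =
      ∑ S : Finset (Fin n), Real.sinh t ^ S.card * Real.cosh t ^ (n - S.card) *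
        ∏ v ∈ S, (-1 : ℝ) ^ degN (erGraph n ω) v := by
    intro ω
    have h : ∀ v, Real.exp (t * (-1 : ℝ) ^ degN (erGraph n ω) v) =
        Real.sinh t * (-1 : ℝ) ^ degN (erGraph n ω) v + Real.cosh t := by
      intro v
      rcases neg_one_pow_eq_or ℝ (degN (erGraph n ω) v) with hv | hv
      · rw [hv, mul_one, mul_one, Real.sinh_add_cosh]
      · rw [hv, mul_neg_one, mul_neg_one, ← Real.cosh_sub_sinh]; ring
    rw [signSum, Finset.mul_sum, Real.exp_sum, Finset.prod_congr rfl fun v _ => h v,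
      Finset.prod_add, Finset.powerset_univ]
    refine Finset.sum_congr rfl fun S _ => ?_
    rw [Finset.prod_mul_distrib, Finset.prod_const, Finset.prod_const,
      Finset.card_univ_sdiff, Fintype.card_fin]
    ring
  rw [ProbabilityTheory.mgf]
  simp_rw [hexp]
  rw [integral_finsetSum _ fun _ _ => Integrable.of_finite, Finset.mul_sum]
  refine Finset.sum_le_sum fun S _ => ?_
  rw [integral_const_mul]
  refine (le_abs_self _).trans ?_
  rw [abs_mul]
  refine mul_le_mul ?_ (abs_integral_parity_le n h0 h1 S) (abs_nonneg _) (Real.exp_pos _).le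
  have hc := Real.cosh_pos t
  have hs : |Real.sinh t| ≤ Real.cosh t := by
    rw [abs_le]
    have e1 := Real.sinh_add_cosh t
    have e2 := Real.cosh_sub_sinh t
    have := Real.exp_pos t
    have := Real.exp_pos (-t)
    constructor <;> linarith
  rw [abs_mul, abs_pow, abs_pow, abs_of_pos hc]
  have hS : S.card ≤ n := by simpa using Finset.card_le_univ S
  calc |Real.sinh t| ^ S.card * Real.cosh t ^ (n - S.card)
      ≤ Real.cosh t ^ S.card * Real.cosh t ^ (n - S.card) := by gcongr
    _ = Real.cosh t ^ n := by rw [← pow_add]; congr 1; omega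
    _ ≤ Real.exp (t ^ 2 / 2) ^ n := by gcongr; exact Real.cosh_le_exp_half_sq t
    _ = Real.exp (n * t ^ 2 / 2) := by rw [← Real.exp_nat_mul]; congr 1; ring

lemma sum_pow_cut_le (n : ℕ) {q x : ℝ} (hq0 : 0 ≤ q) (hx : 0 ≤ x) (hq : q ≤ 1 - 2 * x)
    (hn : n * Real.exp (-(x * n)) ≤ 1) :
    ∑ S : Finset (Fin n), q ^ (S.card * (n - S.card)) ≤ 6 := by
  set y := Real.exp (-(x * n)) with hy
  have hy0 : 0 ≤ y := (Real.exp_pos _).le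
  have hqe : q ≤ Real.exp (-(2 * x)) := by
    have := Real.add_one_le_exp (-(2 * x))
    linarith
  have hterm : ∀ S : Finset (Fin n),
      q ^ (S.card * (n - S.card)) ≤ y ^ S.card + y ^ (n - S.card) := by
    intro S
    have hS : S.card ≤ n := by simpa using Finset.card_le_univ S
    have hScast : ((n - S.card : ℕ) : ℝ) = n - S.card := Nat.cast_sub hS
    have hSR : (S.card : ℝ) ≤ n := by exact_mod_cast hS
    have h1 : q ^ (S.card * (n - S.card)) ≤ Real.exp (-(2 * x * (S.card * (n - S.card)))) := by
      refine (pow_le_pow_left₀ hq0 hqe _).trans (le_of_eq ?_)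
      rw [← Real.exp_nat_mul]
      push_cast [hScast]
      congr 1
      ring
    have hs0 : (0 : ℝ) ≤ S.card := Nat.cast_nonneg _
    rcases le_total (2 * (S.card : ℝ)) n with h | h
    · have : Real.exp (-(2 * x * (S.card * (n - S.card)))) ≤ y ^ S.card := by
        rw [hy, ← Real.exp_nat_mul]
        apply Real.exp_le_exp.mpr
        nlinarith [mul_nonneg (mul_nonneg hx hs0) (by linarith : (0 : ℝ) ≤ n - 2 * S.card)]
      have := pow_nonneg hy0 (n - S.card)
      linarith
    · have : Real.exp (-(2 * x * (S.card * (n - S.card)))) ≤ y ^ (n - S.card) := by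
        rw [hy, ← Real.exp_nat_mul, hScast]
        apply Real.exp_le_exp.mpr
        nlinarith [mul_nonneg (mul_nonneg hx (by linarith : (0 : ℝ) ≤ n - S.card))
          (by linarith : (0 : ℝ) ≤ 2 * S.card - n)]
      have := pow_nonneg hy0 S.card
      linarith
  have hs1 := Finset.sum_pow_mul_eq_add_pow y 1 (Finset.univ : Finset (Fin n))
  have hs2 := Finset.sum_pow_mul_eq_add_pow 1 y (Finset.univ : Finset (Fin n))
  simp only [Finset.powerset_univ, one_pow, mul_one, one_mul, Finset.card_univ,
    Fintype.card_fin] at hs1 hs2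
  have hbin : (1 + y) ^ n ≤ 3 := by
    calc (1 + y) ^ n ≤ Real.exp y ^ n := by
          gcongr
          linarith [Real.add_one_le_exp y]
      _ = Real.exp (n * y) := by rw [← Real.exp_nat_mul]
      _ ≤ Real.exp 1 := Real.exp_le_exp.mpr hn
      _ ≤ 3 := by linarith [Real.exp_one_lt_d9]
  calc ∑ S : Finset (Fin n), q ^ (S.card * (n - S.card))
      ≤ ∑ S : Finset (Fin n), (y ^ S.card + y ^ (n - S.card)) :=
        Finset.sum_le_sum fun S _ => hterm S
    _ = (y + 1) ^ n + (1 + y) ^ n := by rw [Finset.sum_add_distrib, hs1, hs2]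
    _ ≤ 6 := by rw [add_comm y 1]; linarith

lemma measureReal_signSum_le (n : ℕ) {p x s : ℝ} (hx : 0 ≤ x) (hxp : x ≤ p) (hpx : p ≤ 1 - x)
    (hn0 : 0 < n) (hn : n * Real.exp (-(x * n)) ≤ 1) (hs : 0 ≤ s) :
    (erMeasure n p).real {ω | s ≤ |signSum n ω|} ≤ 12 * Real.exp (-(s ^ 2 / (2 * n))) := by
  have h0 : 0 ≤ p := hx.trans hxp
  have h1 : p ≤ 1 := by linarith
  have hnR : (0 : ℝ) < n := by exact_mod_cast hn0
  have hq : |1 - 2 * p| ≤ 1 - 2 * x := by rw [abs_le]; constructor <;> linarith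
  have hmgf : ∀ t, ProbabilityTheory.mgf (signSum n) (erMeasure n p) t ≤
      Real.exp (n * t ^ 2 / 2) * 6 := fun t =>
    (mgf_signSum_le n h0 h1 t).trans
      (mul_le_mul_of_nonneg_left (sum_pow_cut_le n (abs_nonneg _) hx hq hn) (Real.exp_pos _).le)
  have hup : (erMeasure n p).real {ω | s ≤ signSum n ω} ≤ 6 * Real.exp (-(s ^ 2 / (2 * n))) := by
    refine (ProbabilityTheory.measure_ge_le_exp_mul_mgf s (t := s / n) (by positivity)
      Integrable.of_finite).trans ?_
    refine (mul_le_mul_of_nonneg_left (hmgf _) (Real.exp_pos _).le).trans (le_of_eq ?_)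
    rw [← mul_assoc, ← Real.exp_add, mul_comm]
    congr 2
    field_simp
    ring
  have hlow : (erMeasure n p).real {ω | signSum n ω ≤ -s} ≤
      6 * Real.exp (-(s ^ 2 / (2 * n))) := by
    refine (ProbabilityTheory.measure_le_le_exp_mul_mgf (-s) (t := -(s / n))
      (neg_nonpos.mpr (by positivity)) Integrable.of_finite).trans ?_
    refine (mul_le_mul_of_nonneg_left (hmgf _) (Real.exp_pos _).le).trans (le_of_eq ?_)
    rw [← mul_assoc, ← Real.exp_add, mul_comm]
    congr 2
    field_simp
    ring
  have hsub : {ω | s ≤ |signSum n ω|} ⊆ {ω | s ≤ signSum n ω} ∪ {ω | signSum n ω ≤ -s} := by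
    intro ω hω
    rcases le_abs.mp (Set.mem_ofPred.mp hω) with h | h
    · exact Or.inl h
    · exact Or.inr (Set.mem_ofPred.mpr (by linarith))
  refine (measureReal_mono hsub).trans ((measureReal_union_le _ _).trans ?_)
  linarith

lemma integral_prod_indicator (n : ℕ) {p : ℝ} (h0 : 0 ≤ p) (h1 : p ≤ 1)
    (E : Finset (Sym2 (Fin n))) :
    ∫ ω, ∏ e ∈ E, (if ω e = true then (1 : ℝ) else 0) ∂erMeasure n p = p ^ E.card := by
  classical
  set f : Sym2 (Fin n) → Bool → ℝ := fun e b => if e ∈ E then (if b = true then 1 else 0) else 1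
    with hf
  have h : ∀ ω : Sym2 (Fin n) → Bool, ∏ e ∈ E, (if ω e = true then (1 : ℝ) else 0) =
      ∏ e, f e (ω e) := by
    intro ω
    simp [hf, Finset.prod_ite_mem]
  simp_rw [h]
  rw [integral_erMeasure_prod n h0 h1]
  have h2 : ∀ e, p * f e true + (1 - p) * f e false = if e ∈ E then p else 1 := by
    intro e
    by_cases he : e ∈ E <;> simp [hf, he]
  rw [Finset.prod_congr rfl fun e _ => h2 e, Finset.prod_ite_mem, Finset.univ_inter,
    Finset.prod_const]

lemma measureReal_no_common_neighbor (n : ℕ) {p : ℝ} (h0 : 0 ≤ p) (h1 : p ≤ 1) {u v : Fin n}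
    (huv : u ≠ v) (W : Finset (Fin n)) (hv : v ∉ W) :
    (erMeasure n p).real {ω | ∀ w ∈ W, ¬ (ω s(u, w) = true ∧ ω s(v, w) = true)} =
      (1 - p ^ 2) ^ W.card := by
  classical
  set X : Sym2 (Fin n) → (Sym2 (Fin n) → Bool) → ℝ :=
    fun e ω => if ω e = true then 1 else 0 with hX
  set B : Set (Sym2 (Fin n) → Bool) :=
    {ω | ∀ w ∈ W, ¬ (ω s(u, w) = true ∧ ω s(v, w) = true)} with hB
  have hind : ∀ ω, B.indicator (1 : (Sym2 (Fin n) → Bool) → ℝ) ω =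
      ∏ w ∈ W, (1 + -(X s(u, w) ω * X s(v, w) ω)) := by
    intro ω
    by_cases hω : ω ∈ B
    · rw [Set.indicator_of_mem hω, Pi.one_apply, eq_comm]
      refine Finset.prod_eq_one fun w hw => ?_
      have := (Set.mem_ofPred.mp hω) w hw
      by_cases h : ω s(u, w) = true <;> simp_all
    · rw [Set.indicator_of_notMem hω, eq_comm]
      rw [hB, Set.mem_ofPred] at hω
      push Not at hω
      obtain ⟨w, hw, h⟩ := hω
      exact Finset.prod_eq_zero hw (by simp [hX, h])
  have hterm : ∀ T ∈ W.powerset, ∫ ω, ∏ w ∈ T, -(X s(u, w) ω * X s(v, w) ω) ∂erMeasure n p =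
      ∏ w ∈ T, -(p ^ 2) := by
    intro T hT
    have hTW := Finset.mem_powerset.mp hT
    have hinj : ∀ z : Fin n, Set.InjOn (fun w => s(z, w)) (T : Set (Fin n)) := by
      intro z a _ b _ h
      exact Sym2.congr_right.mp h
    have hdisj : Disjoint (T.image fun w => s(u, w)) (T.image fun w => s(v, w)) := by
      rw [Finset.disjoint_left]
      intro e he he'
      obtain ⟨a, ha, rfl⟩ := Finset.mem_image.mp he
      obtain ⟨b, hb, h⟩ := Finset.mem_image.mp he'
      rw [Sym2.eq_iff] at h
      rcases h with ⟨h, _⟩ | ⟨h, _⟩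
      · exact huv h.symm
      · exact hv (hTW (h ▸ ha))
    have hpr : ∀ ω, ∏ w ∈ T, -(X s(u, w) ω * X s(v, w) ω) =
        (-1) ^ T.card *
          ∏ e ∈ (T.image fun w => s(u, w)) ∪ (T.image fun w => s(v, w)), X e ω := by
      intro ω
      rw [Finset.prod_neg, Finset.prod_mul_distrib, Finset.prod_union hdisj,
        Finset.prod_image (hinj u), Finset.prod_image (hinj v)]
    simp_rw [hpr]
    rw [integral_const_mul, integral_prod_indicator n h0 h1, Finset.card_union_of_disjoint hdisj,
      Finset.card_image_of_injOn (hinj u), Finset.card_image_of_injOn (hinj v),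
      Finset.prod_neg, Finset.prod_const]
    ring
  rw [← integral_indicator_one (Set.toFinite B).measurableSet]
  simp_rw [hind, Finset.prod_one_add]
  rw [integral_finsetSum _ fun _ _ => Integrable.of_finite, Finset.sum_congr rfl hterm,
    ← Finset.prod_one_add, Finset.prod_const]
  ring

lemma measureReal_not_robustlyLinked_le (n : ℕ) {p : ℝ} (h0 : 0 ≤ p) (h1 : p ≤ 1) :
    (erMeasure n p).real {ω | ¬ RobustlyLinked (erGraph n ω)} ≤
      (n : ℝ) ^ 4 * (1 - p ^ 2) ^ (n - 4) := by
  classical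
  set I := (Finset.univ : Finset (Fin n × Fin n × Fin n × Fin n)).filter fun i => i.1 ≠ i.2.1
  let W : Fin n × Fin n × Fin n × Fin n → Finset (Fin n) :=
    fun i => ({i.1, i.2.1, i.2.2.1, i.2.2.2} : Finset (Fin n))ᶜ
  have hp2 : p ^ 2 ≤ 1 := pow_le_one₀ h0 h1
  have hsub : {ω | ¬ RobustlyLinked (erGraph n ω)} ⊆
      ⋃ i ∈ I, {ω | ∀ w ∈ W i, ¬ (ω s(i.1, w) = true ∧ ω s(i.2.1, w) = true)} := by
    intro ω hω
    rw [Set.mem_ofPred, RobustlyLinked] at hω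
    push Not at hω
    obtain ⟨u, v, huv, a, b, h⟩ := hω
    simp only [Set.mem_iUnion, Set.mem_ofPred_eq]
    refine ⟨(u, v, a, b), by simp [I, huv], fun w hw hcon => ?_⟩
    simp only [W, Finset.mem_compl, Finset.mem_insert, Finset.mem_singleton, not_or] at hw
    refine h w hw.2.2.1 hw.2.2.2 ?_ ?_
    · rw [erGraph, SimpleGraph.fromEdgeSet_adj]
      exact ⟨hcon.1, Ne.symm hw.1⟩
    · rw [erGraph, SimpleGraph.fromEdgeSet_adj]
      exact ⟨hcon.2, Ne.symm hw.2.1⟩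
  refine (measureReal_mono hsub (measure_ne_top _ _)).trans ((measureReal_biUnion_finset_le _ _).trans ?_)
  have hbound : ∀ i ∈ I, (erMeasure n p).real
      {ω | ∀ w ∈ W i, ¬ (ω s(i.1, w) = true ∧ ω s(i.2.1, w) = true)} ≤
        (1 - p ^ 2) ^ (n - 4) := by
    intro i hi
    rw [measureReal_no_common_neighbor n h0 h1 (by simpa [I] using hi) _ (by simp [W])]
    refine pow_le_pow_of_le_one (by linarith) (by nlinarith [sq_nonneg p]) ?_
    rw [Finset.card_compl, Fintype.card_fin]
    have := Finset.card_le_four (a := i.1) (b := i.2.1) (c := i.2.2.1) (d := i.2.2.2)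
    omega
  refine (Finset.sum_le_card_nsmul _ _ _ hbound).trans ?_
  rw [nsmul_eq_mul]
  refine mul_le_mul_of_nonneg_right ?_ (pow_nonneg (by linarith) _)
  have : I.card ≤ n ^ 4 := by
    refine (Finset.card_le_univ _).trans (le_of_eq ?_)
    simp only [Fintype.card_prod, Fintype.card_fin]
    ring
  exact_mod_cast this

lemma measureReal_deviation_le (n : ℕ) (hn : 2 ≤ n) {p x s : ℝ} (hx : 0 ≤ x) (hxp : x ≤ p)
    (hpx : p ≤ 1 - x) (hxn : n * Real.exp (-(x * n)) ≤ 1) (hs : 0 ≤ s) :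
    (erMeasure n p).real
      {ω | (n : ℝ) / 4 - s ≤ (Nedit (erGraph n ω) : ℝ) ∧
        (Nedit (erGraph n ω) : ℝ) ≤ (n : ℝ) / 4 + s}ᶜ ≤
      (n : ℝ) ^ 4 * (1 - p ^ 2) ^ (n - 4) + 12 * Real.exp (-((4 * s) ^ 2 / (2 * n))) := by
  classical
  have h0 : 0 ≤ p := hx.trans hxp
  have h1 : p ≤ 1 := by linarith
  have : Nontrivial (Fin n) := Fin.nontrivial_iff_two_le.mpr hn
  refine (measureReal_mono (s₂ := {ω | ¬ RobustlyLinked (erGraph n ω)} ∪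
    {ω | 4 * s ≤ |signSum n ω|}) ?_ (measure_ne_top _ _)).trans ((measureReal_union_le _ _).trans
      (add_le_add (measureReal_not_robustlyLinked_le n h0 h1)
        (measureReal_signSum_le n hx hxp hpx (by omega) hxn (by linarith))))
  intro ω hω
  by_cases hR : RobustlyLinked (erGraph n ω)
  · right
    rw [Set.mem_ofPred]
    have hN : (2 * Nedit (erGraph n ω) : ℝ) =
        ((Finset.univ.filter fun v => Odd (degN (erGraph n ω) v)).card : ℝ) := by
      exact_mod_cast two_mul_Nedit (erGraph n ω) hR
    rw [signSum_eq, ← hN]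
    by_contra hlt
    rw [not_le, abs_lt] at hlt
    refine hω (Set.mem_ofPred.mpr ⟨?_, ?_⟩) <;> linarith
  · exact Or.inl hR

lemma eventually_tail_le (η r : ℝ) (hη : 0 < η) (hr : 0 < r) :
    ∀ᶠ n : ℕ in Filter.atTop, 8 ≤ n ∧ 2 * r + 10 ≤ Real.log n ∧
      (r + 4) * Real.log n ≤ (n : ℝ) ^ (2 * η) := by
  have hlog : Filter.Tendsto (fun n : ℕ => Real.log n) Filter.atTop Filter.atTop :=
    Real.tendsto_log_atTop.comp tendsto_natCast_atTop_atTop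
  have hlittle := ((isLittleO_log_rpow_atTop (by positivity : 0 < 2 * η)).bound
    (by positivity : 0 < (r + 4)⁻¹))
  filter_upwards [Filter.eventually_ge_atTop 8, hlog.eventually_ge_atTop (2 * r + 10),
    tendsto_natCast_atTop_atTop.eventually hlittle] with n h1 h2 h3
  refine ⟨h1, h2, ?_⟩
  rw [Real.norm_of_nonneg (by linarith), Real.norm_of_nonneg (by positivity)] at h3
  rwa [inv_mul_eq_div, le_div_iff₀ (by positivity), mul_comm] at h3

/-- Main deviation estimate for the Eulerian edit number: with probability at least
`1 - 1/n^r`, `N_edit(G(n,p))` lies between `n/4 - n^(1/2+η)` and `n/4 + n^(1/2+η)`. -/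
theorem edit_number_deviation (η : ℝ) (hη : 0 < η) (r : ℝ) (hr : 0 < r) :
    ∃ n0 : ℕ, ∀ n : ℕ, n0 ≤ n → ∀ p : ℝ,
      (Real.log n) ^ 2 / Real.sqrt n ≤ p → p ≤ 1 - (Real.log n) ^ 2 / Real.sqrt n →
      ENNReal.ofReal (1 - 1 / (n : ℝ) ^ r)
        ≤ erMeasure n p {ω |
            (n : ℝ) / 4 - (n : ℝ) ^ ((1 : ℝ) / 2 + η) ≤ (Nedit (erGraph n ω) : ℝ) ∧
            (Nedit (erGraph n ω) : ℝ) ≤ (n : ℝ) / 4 + (n : ℝ) ^ ((1 : ℝ) / 2 + η)} := by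
  obtain ⟨n0, hn0⟩ := Filter.eventually_atTop.mp (eventually_tail_le η r hη hr)
  refine ⟨n0, fun n hn p hp1 hp2 => ?_⟩
  obtain ⟨h8, hL, hpow⟩ := hn0 n hn
  have h8R : (8 : ℝ) ≤ n := by exact_mod_cast h8
  have hnpos : (0 : ℝ) < n := by linarith
  set L := Real.log n with hLdef
  set x := L ^ 2 / Real.sqrt n with hxdef
  have hexpL : Real.exp L = n := Real.exp_log hnpos
  have hsq : Real.sqrt n * Real.sqrt n = n := Real.mul_self_sqrt hnpos.le
  have hsq1 : 1 ≤ Real.sqrt n := Real.one_le_sqrt.mpr (by linarith)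
  have hx : 0 ≤ x := by positivity
  have h0 : 0 ≤ p := hx.trans hp1
  have h1 : p ≤ 1 := by linarith
  have hxn : n * Real.exp (-(x * n)) ≤ 1 := by
    have : x * n = L ^ 2 * Real.sqrt n := by
      rw [hxdef, div_mul_eq_mul_div, div_eq_iff (by positivity), mul_assoc, hsq]
    rw [this, ← hexpL, ← Real.exp_add, hexpL, Real.exp_le_one_iff]
    nlinarith [mul_nonneg (sq_nonneg L) (by linarith : (0 : ℝ) ≤ Real.sqrt n - 1)]
  have hnr : 1 / (n : ℝ) ^ r = Real.exp (-(r * L)) := by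
    rw [Real.rpow_def_of_pos hnpos, one_div, ← Real.exp_neg, mul_comm]
  have htail1 : (n : ℝ) ^ 4 * (1 - p ^ 2) ^ (n - 4) ≤ Real.exp (-(r * L)) / 2 := by
    have hp2 : L ^ 4 / n ≤ p ^ 2 := by
      have : x ^ 2 = L ^ 4 / n := by
        rw [hxdef, div_pow, Real.sq_sqrt hnpos.le]; ring
      rw [← this]
      gcongr
    have hcast : ((n - 4 : ℕ) : ℝ) = n - 4 := by
      rw [Nat.cast_sub (by omega)]; norm_num
    have hexpo : L ^ 4 / 2 ≤ ((n - 4 : ℕ) : ℝ) * p ^ 2 := by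
      rw [hcast]
      have e1 : L ^ 4 ≤ p ^ 2 * n := (div_le_iff₀ hnpos).mp hp2
      nlinarith [mul_nonneg (sq_nonneg p) (by linarith : (0 : ℝ) ≤ n - 8)]
    have hL4 : (4 + r) * L + 1 ≤ L ^ 4 / 2 := by
      have e1 : L ^ 2 ≤ L ^ 4 := pow_le_pow_right₀ (by linarith) (by norm_num)
      nlinarith
    calc (n : ℝ) ^ 4 * (1 - p ^ 2) ^ (n - 4)
        ≤ Real.exp L ^ 4 * Real.exp (-p ^ 2) ^ (n - 4) := by
          rw [hexpL]
          have : p ^ 2 ≤ 1 := pow_le_one₀ h0 h1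
          gcongr
          linarith [Real.add_one_le_exp (-p ^ 2)]
      _ = Real.exp (4 * L - ((n - 4 : ℕ) : ℝ) * p ^ 2) := by
          rw [← Real.exp_nat_mul, ← Real.exp_nat_mul, ← Real.exp_add]
          congr 1
          push_cast
          ring
      _ ≤ Real.exp (-(r * L) + -1) := Real.exp_le_exp.mpr (by linarith)
      _ ≤ Real.exp (-(r * L)) / 2 := by
          rw [Real.exp_add, div_eq_mul_inv]
          gcongr
          rw [Real.exp_neg]
          gcongr
          linarith [Real.add_one_le_exp 1]
  have htail2 : 12 * Real.exp (-((4 * (n : ℝ) ^ ((1 : ℝ) / 2 + η)) ^ 2 / (2 * n))) ≤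
      Real.exp (-(r * L)) / 2 := by
    have hpw : ((n : ℝ) ^ ((1 : ℝ) / 2 + η)) ^ 2 = n * (n : ℝ) ^ (2 * η) := by
      rw [← Real.rpow_natCast, ← Real.rpow_mul hnpos.le]
      rw [show ((1 : ℝ) / 2 + η) * (2 : ℕ) = 1 + 2 * η by push_cast; ring,
        Real.rpow_add hnpos, Real.rpow_one]
    have hexpo : (4 * (n : ℝ) ^ ((1 : ℝ) / 2 + η)) ^ 2 / (2 * n) = 8 * (n : ℝ) ^ (2 * η) := by
      rw [mul_pow, hpw]
      field_simp
      ring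
    have h24 : (24 : ℝ) ≤ Real.exp 24 := by linarith [Real.add_one_le_exp (24 : ℝ)]
    rw [hexpo]
    calc 12 * Real.exp (-(8 * (n : ℝ) ^ (2 * η)))
        ≤ 12 * Real.exp (-(r * L) + -24) := by
          gcongr
          nlinarith
      _ ≤ Real.exp (-(r * L)) / 2 := by
          rw [Real.exp_add, Real.exp_neg 24]
          have : (Real.exp 24)⁻¹ ≤ (24 : ℝ)⁻¹ := by gcongr
          nlinarith [Real.exp_pos (-(r * L))]
  have := isProbabilityMeasure_erMeasure n h0 h1
  have hdev := measureReal_deviation_le n (by omega) hx hp1 hp2 hxn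
    (Real.rpow_nonneg hnpos.le ((1 : ℝ) / 2 + η))
  rw [probReal_compl_eq_one_sub (Set.toFinite _).measurableSet] at hdev
  rw [← ENNReal.ofReal_toReal (measure_ne_top (erMeasure n p) _)]
  apply ENNReal.ofReal_le_ofReal
  rw [Measure.real] at hdev
  rw [hnr]
  linarith
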